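/- arXiv:2604.25144 — 2 statements merged into one kernel-verified Lean document; each statement's English description precedes it below -/
import Mathlib

section
/- Let n ≥ 1 and p > 1. For every real c > (n/p)^p there exists a nonzero nonnegative smooth function f : ℝ^n × ℝ → ℝ with compact support contained in H = ℝ^n × (0, ∞) such that ∫_H ‖∇f(x,y)‖^p · y^{p−n−1} dx dy < c · ∫_H f(x,y)^p · y^{−n−1} dx dy. -/
open MeasureTheory

noncomputable section

/-- The `i`-th horizontal coordinate direction in `ℝ^n × ℝ`. -/
def ex (n : ℕ) (i : Fin n) : (Fin n → ℝ) × ℝ := (Pi.single i 1, 0)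

/-- The vertical coordinate direction in `ℝ^n × ℝ`. -/
def ey (n : ℕ) : (Fin n → ℝ) × ℝ := (0, 1)

/-- Partial derivative in the direction `v`. -/
def pderiv' (n : ℕ) (v : (Fin n → ℝ) × ℝ) (f : (Fin n → ℝ) × ℝ → ℝ) :
    (Fin n → ℝ) × ℝ → ℝ := fun p => fderiv ℝ f p v

/-- The Euclidean Laplacian on `ℝ^n × ℝ`: the sum of the second partial
derivatives in all `n+1` variables. -/
def eucLap (n : ℕ) (f : (Fin n → ℝ) × ℝ → ℝ) : (Fin n → ℝ) × ℝ → ℝ := fun p =>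
  (∑ i, pderiv' n (ex n i) (pderiv' n (ex n i) f) p) +
    pderiv' n (ey n) (pderiv' n (ey n) f) p

/-- The squared norm of the Euclidean gradient of `f` on `ℝ^n × ℝ`. -/
def gradSq (n : ℕ) (f : (Fin n → ℝ) × ℝ → ℝ) : (Fin n → ℝ) × ℝ → ℝ := fun p =>
  (∑ i, (pderiv' n (ex n i) f p) ^ 2) + (pderiv' n (ey n) f p) ^ 2

/-- The hyperbolic Laplacian of the upper half-space model:
`(Lf)(x,y) = y²·(Δf)(x,y) − (n−1)·y·(∂_y f)(x,y)`. -/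
def hypLap (n : ℕ) (f : (Fin n → ℝ) × ℝ → ℝ) : (Fin n → ℝ) × ℝ → ℝ := fun p =>
  p.2 ^ 2 * eucLap n f p - ((n : ℝ) - 1) * p.2 * pderiv' n (ey n) f p

/-- The open upper half-space `H = ℝ^n × (0, ∞)`. -/
def upperH (n : ℕ) : Set ((Fin n → ℝ) × ℝ) := {p | 0 < p.2}

end

open Filter Topology

/-- The map `(u, t) ↦ (u / ε, exp (t / ε))`, parametrising the upper half-space. -/
noncomputable def halfSpaceParam (n : ℕ) (ε : ℝ) (q : (Fin n → ℝ) × ℝ) : (Fin n → ℝ) × ℝ :=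
  (ε⁻¹ • q.1, Real.exp (ε⁻¹ * q.2))

/-- The function `y ^ a * F (ε x, ε log y)` on the upper half-space, extended by zero. -/
noncomputable def powerProfile (n : ℕ) (a ε : ℝ) (F : (Fin n → ℝ) × ℝ → ℝ)
    (q : (Fin n → ℝ) × ℝ) : ℝ :=
  if 0 < q.2 then q.2 ^ a * F (ε • q.1, ε * Real.log q.2) else 0

/-- The Euclidean gradient norm of `powerProfile n a ε F`, up to a power of `y`, in the
coordinates of `halfSpaceParam`. -/
noncomputable def profileGrad (n : ℕ) (a ε : ℝ) (F : (Fin n → ℝ) × ℝ → ℝ)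
    (q : (Fin n → ℝ) × ℝ) : ℝ :=
  √((∑ i, (ε * Real.exp (ε⁻¹ * q.2) * pderiv' n (ex n i) F q) ^ 2) +
    (a * F q + ε * pderiv' n (ey n) F q) ^ 2)

section

variable {n : ℕ} {a ε p : ℝ} {F : (Fin n → ℝ) × ℝ → ℝ}

theorem halfSpaceParam_image_univ (hε : 0 < ε) :
    halfSpaceParam n ε '' Set.univ = upperH n := by
  ext q
  simp only [Set.image_univ, Set.mem_range, upperH, Set.mem_ofPred_eq]
  constructor
  · rintro ⟨r, rfl⟩
    exact Real.exp_pos _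
  · intro hq
    refine ⟨(ε • q.1, ε * Real.log q.2), Prod.ext ?_ ?_⟩
    · simp [halfSpaceParam, smul_smul, hε.ne']
    · simp [halfSpaceParam, hε.ne', Real.exp_log hq]

theorem halfSpaceParam_injective (hε : 0 < ε) : Function.Injective (halfSpaceParam n ε) := by
  rintro ⟨x, s⟩ ⟨y, t⟩ h
  simp only [halfSpaceParam, Prod.mk.injEq, Real.exp_eq_exp] at h
  refine Prod.ext ?_ ?_
  · exact smul_right_injective _ (inv_ne_zero hε.ne') h.1
  · exact mul_left_cancel₀ (inv_ne_zero hε.ne') h.2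

theorem hasFDerivAt_halfSpaceParam (ε : ℝ) (q : (Fin n → ℝ) × ℝ) :
    HasFDerivAt (halfSpaceParam n ε)
      ((ε⁻¹ • ContinuousLinearMap.id ℝ (Fin n → ℝ)).prodMap
        ((Real.exp (ε⁻¹ * q.2) * ε⁻¹) • ContinuousLinearMap.id ℝ ℝ)) q := by
  have h1 : HasFDerivAt (fun q : (Fin n → ℝ) × ℝ => ε⁻¹ • q.1)
      (ε⁻¹ • ContinuousLinearMap.fst ℝ (Fin n → ℝ) ℝ) q := hasFDerivAt_fst.const_smul ε⁻¹
  have h2 : HasFDerivAt (fun q : (Fin n → ℝ) × ℝ => Real.exp (ε⁻¹ * q.2))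
      (Real.exp (ε⁻¹ * q.2) • ε⁻¹ • ContinuousLinearMap.snd ℝ (Fin n → ℝ) ℝ) q :=
    (hasFDerivAt_snd.const_mul _).exp
  refine (h1.prodMk h2).congr_fderiv ?_
  ext v <;> simp

theorem integral_upperH (hε : 0 < ε) (g : (Fin n → ℝ) × ℝ → ℝ) :
    ∫ q in upperH n, g q = ε⁻¹ ^ (n + 1) *
      ∫ q, Real.exp (ε⁻¹ * q.2) * g (halfSpaceParam n ε q) := by
  have : (volume : Measure ((Fin n → ℝ) × ℝ)).IsAddHaarMeasure :=
    inferInstanceAs ((volume : Measure (Fin n → ℝ)).prod (volume : Measure ℝ)).IsAddHaarMeasure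
  rw [← halfSpaceParam_image_univ hε,
    integral_image_eq_integral_abs_det_fderiv_smul volume MeasurableSet.univ
      (fun q _ => (hasFDerivAt_halfSpaceParam ε q).hasFDerivWithinAt)
      (halfSpaceParam_injective hε).injOn,
    setIntegral_univ, ← integral_const_mul]
  refine integral_congr_ae (ae_of_all _ fun q => ?_)
  have hdet : ((ε⁻¹ • ContinuousLinearMap.id ℝ (Fin n → ℝ)).prodMap
        ((Real.exp (ε⁻¹ * q.2) * ε⁻¹) • ContinuousLinearMap.id ℝ ℝ)).det =
      ε⁻¹ ^ n * (Real.exp (ε⁻¹ * q.2) * ε⁻¹) := by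
    rw [ContinuousLinearMap.det, ContinuousLinearMap.coe_prodMap, LinearMap.det_prodMap]
    simp
  have hpos : 0 < ε⁻¹ ^ n * (Real.exp (ε⁻¹ * q.2) * ε⁻¹) := by positivity
  simp only [hdet, abs_of_pos hpos, smul_eq_mul]
  ring

theorem powerProfile_halfSpaceParam (hε : 0 < ε) (q : (Fin n → ℝ) × ℝ) :
    powerProfile n a ε F (halfSpaceParam n ε q) = Real.exp (ε⁻¹ * q.2) ^ a * F q := by
  simp [powerProfile, halfSpaceParam, Real.exp_pos, smul_smul, hε.ne']

theorem powerProfile_nonneg (hF : ∀ q, 0 ≤ F q) (q : (Fin n → ℝ) × ℝ) :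
    0 ≤ powerProfile n a ε F q := by
  unfold powerProfile
  split_ifs with h
  · exact mul_nonneg (Real.rpow_nonneg h.le _) (hF _)
  · rfl

theorem powerProfile_ne_zero (hε : 0 < ε) (hF : F ≠ 0) : powerProfile n a ε F ≠ 0 := by
  obtain ⟨q, hq⟩ := Function.ne_iff.mp hF
  refine fun h => ?_
  have := powerProfile_halfSpaceParam (a := a) (F := F) hε q
  rw [h] at this
  exact mul_ne_zero (Real.rpow_pos_of_pos (Real.exp_pos _) _).ne' hq this.symm

theorem continuous_halfSpaceParam (ε : ℝ) : Continuous (halfSpaceParam n ε) := by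
  unfold halfSpaceParam
  fun_prop

theorem support_powerProfile_subset (hε : 0 < ε) :
    Function.support (powerProfile n a ε F) ⊆ halfSpaceParam n ε '' tsupport F := by
  intro q hq
  have hq2 : 0 < q.2 := by
    by_contra h
    exact hq (if_neg h)
  obtain ⟨r, -, rfl⟩ : q ∈ halfSpaceParam n ε '' Set.univ := by
    rw [halfSpaceParam_image_univ hε]
    exact hq2
  refine ⟨r, subset_tsupport _ fun h => hq ?_, rfl⟩
  rw [powerProfile_halfSpaceParam hε, h, mul_zero]

theorem tsupport_powerProfile_subset (hε : 0 < ε) (hF : HasCompactSupport F) :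
    tsupport (powerProfile n a ε F) ⊆ halfSpaceParam n ε '' tsupport F :=
  closure_minimal (support_powerProfile_subset hε)
    (hF.isCompact.image (continuous_halfSpaceParam ε)).isClosed

theorem hasCompactSupport_powerProfile (hε : 0 < ε) (hF : HasCompactSupport F) :
    HasCompactSupport (powerProfile n a ε F) :=
  (hF.isCompact.image (continuous_halfSpaceParam ε)).of_isClosed_subset
    (isClosed_tsupport _) (tsupport_powerProfile_subset hε hF)

theorem tsupport_powerProfile_subset_upperH (hε : 0 < ε) (hF : HasCompactSupport F) :
    tsupport (powerProfile n a ε F) ⊆ upperH n :=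
  (tsupport_powerProfile_subset hε hF).trans
    ((Set.image_mono (Set.subset_univ _)).trans (halfSpaceParam_image_univ hε).subset)

theorem powerProfile_eventuallyEq {q : (Fin n → ℝ) × ℝ} (hq : 0 < q.2) :
    powerProfile n a ε F =ᶠ[𝓝 q] fun r => r.2 ^ a * F (ε • r.1, ε * Real.log r.2) := by
  filter_upwards [continuousAt_snd.eventually (lt_mem_nhds hq)] with r hr
  exact if_pos hr

theorem contDiff_powerProfile (hε : 0 < ε) (hF : HasCompactSupport F)
    (hF' : ContDiff ℝ (⊤ : ℕ∞) F) : ContDiff ℝ (⊤ : ℕ∞) (powerProfile n a ε F) := by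
  refine contDiff_iff_contDiffAt.mpr fun q => ?_
  by_cases hq : q ∈ tsupport (powerProfile n a ε F)
  swap
  · exact contDiffAt_const.congr_of_eventuallyEq (notMem_tsupport_iff_eventuallyEq.mp hq)
  have hq2 : 0 < q.2 := tsupport_powerProfile_subset_upperH hε hF hq
  refine ContDiffAt.congr_of_eventuallyEq ?_ (powerProfile_eventuallyEq hq2)
  refine (contDiffAt_snd.rpow_const_of_ne hq2.ne').mul (hF'.contDiffAt.comp q ?_)
  exact (contDiffAt_fst.const_smul ε).prodMk (contDiffAt_const.mul (contDiffAt_snd.log hq2.ne'))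

theorem pderiv_powerProfile (hε : 0 < ε) (hF : Differentiable ℝ F) (q v : (Fin n → ℝ) × ℝ) :
    pderiv' n v (powerProfile n a ε F) (halfSpaceParam n ε q) =
      Real.exp (ε⁻¹ * q.2) ^ (a - 1) * (a * v.2 * F q +
        fderiv ℝ F q ((ε * Real.exp (ε⁻¹ * q.2)) • v.1, ε * v.2)) := by
  set y := Real.exp (ε⁻¹ * q.2) with hy
  have hy0 : 0 < y := Real.exp_pos _
  set r := halfSpaceParam n ε q with hr
  have hr2 : r.2 = y := rfl
  have hback : (ε • r.1, ε * Real.log r.2) = q := by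
    simp [hr, halfSpaceParam, smul_smul, hε.ne']
  have hlog : HasFDerivAt (fun s : (Fin n → ℝ) × ℝ => (ε • s.1, ε * Real.log s.2))
      ((ε • ContinuousLinearMap.fst ℝ (Fin n → ℝ) ℝ).prod
        (ε • r.2⁻¹ • ContinuousLinearMap.snd ℝ (Fin n → ℝ) ℝ)) r :=
    (hasFDerivAt_fst.const_smul ε).prodMk ((hasFDerivAt_snd.log hy0.ne').const_mul ε)
  have hcomp := HasFDerivAt.comp r (by rw [hback]; exact (hF q).hasFDerivAt) hlog
  have hpow : HasFDerivAt (fun s : (Fin n → ℝ) × ℝ => s.2 ^ a)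
      ((a * r.2 ^ (a - 1)) • ContinuousLinearMap.snd ℝ (Fin n → ℝ) ℝ) r :=
    hasFDerivAt_snd.rpow_const (Or.inl hy0.ne')
  have hmul := (hpow.mul hcomp).congr_of_eventuallyEq
    (powerProfile_eventuallyEq (F := F) (a := a) (ε := ε) (q := r) hy0)
  rw [pderiv', hmul.fderiv]
  have hsplit : ((ε * y) • v.1, ε * v.2) = y • (ε • v.1, ε * (y⁻¹ * v.2)) := by
    refine Prod.ext ?_ ?_
    · simp [smul_smul, mul_comm]
    · simp only [Prod.smul_mk, smul_eq_mul]
      field_simp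
  have hya : y ^ a = y ^ (a - 1) * y := by
    rw [← Real.rpow_add_one hy0.ne', sub_add_cancel]
  rw [hsplit, map_smul]
  simp only [add_apply, smul_apply, Function.comp_apply,
    hback, ContinuousLinearMap.comp_apply, ContinuousLinearMap.prod_apply, smul_eq_mul,
    ContinuousLinearMap.coe_fst', ContinuousLinearMap.coe_snd']
  rw [hr2, hya]
  ring

theorem sqrt_gradSq_powerProfile (hε : 0 < ε) (hF : Differentiable ℝ F)
    (q : (Fin n → ℝ) × ℝ) :
    √(gradSq n (powerProfile n a ε F) (halfSpaceParam n ε q)) =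
      Real.exp (ε⁻¹ * q.2) ^ (a - 1) * profileGrad n a ε F q := by
  have hx (i : Fin n) : pderiv' n (ex n i) (powerProfile n a ε F) (halfSpaceParam n ε q) =
      Real.exp (ε⁻¹ * q.2) ^ (a - 1) *
        (ε * Real.exp (ε⁻¹ * q.2) * pderiv' n (ex n i) F q) := by
    rw [pderiv_powerProfile hε hF, pderiv', ← smul_eq_mul (ε * _), ← map_smul]
    simp [ex]
  have hy : pderiv' n (ey n) (powerProfile n a ε F) (halfSpaceParam n ε q) =
      Real.exp (ε⁻¹ * q.2) ^ (a - 1) * (a * F q + ε * pderiv' n (ey n) F q) := by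
    rw [pderiv_powerProfile hε hF, pderiv', ← smul_eq_mul ε (fderiv ℝ F q (ey n)), ← map_smul]
    simp [ey]
  simp only [gradSq, hx, hy, mul_pow _ _ 2, ← Finset.mul_sum, ← mul_add, profileGrad]
  simp only [← mul_pow]
  rw [Real.sqrt_mul (sq_nonneg _), Real.sqrt_sq (Real.rpow_nonneg (Real.exp_pos _).le _)]

theorem integral_powerProfile (hε : 0 < ε) (hp : 0 < p) (hF : ∀ q, 0 ≤ F q) :
    ∫ q in upperH n, powerProfile n (n / p) ε F q ^ p * q.2 ^ (-(n : ℝ) - 1) =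
      ε⁻¹ ^ (n + 1) * ∫ q, F q ^ p := by
  rw [integral_upperH hε]
  congr 2 with q
  have hy : 0 < Real.exp (ε⁻¹ * q.2) := Real.exp_pos _
  rw [powerProfile_halfSpaceParam hε]
  simp only [halfSpaceParam]
  generalize Real.exp (ε⁻¹ * q.2) = y at hy
  rw [Real.mul_rpow (Real.rpow_nonneg hy.le _) (hF q), ← Real.rpow_mul hy.le,
    div_mul_cancel₀ _ hp.ne']
  have : y ^ (n : ℝ) * y ^ (-(n : ℝ) - 1) * y = 1 := by
    rw [← Real.rpow_add hy, ← Real.rpow_add_one hy.ne']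
    ring_nf
    exact Real.rpow_zero y
  linear_combination F q ^ p * this

theorem integral_gradSq_powerProfile (hε : 0 < ε) (hp : 0 < p) (hF : Differentiable ℝ F) :
    ∫ q in upperH n, √(gradSq n (powerProfile n (n / p) ε F) q) ^ p * q.2 ^ (p - n - 1) =
      ε⁻¹ ^ (n + 1) * ∫ q, profileGrad n (n / p) ε F q ^ p := by
  rw [integral_upperH hε]
  congr 2 with q
  have hy : 0 < Real.exp (ε⁻¹ * q.2) := Real.exp_pos _
  rw [sqrt_gradSq_powerProfile hε hF]
  simp only [halfSpaceParam]
  have hG : 0 ≤ profileGrad n (n / p) ε F q := Real.sqrt_nonneg _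
  generalize Real.exp (ε⁻¹ * q.2) = y at hy
  rw [Real.mul_rpow (Real.rpow_nonneg hy.le _) hG, ← Real.rpow_mul hy.le,
    sub_mul, div_mul_cancel₀ _ hp.ne', one_mul]
  have : y ^ ((n : ℝ) - p) * y ^ (p - n - 1) * y = 1 := by
    rw [← Real.rpow_add hy, ← Real.rpow_add_one hy.ne']
    ring_nf
    exact Real.rpow_zero y
  linear_combination profileGrad n (n / p) ε F q ^ p * this

theorem continuous_pderiv (hF : ContDiff ℝ (⊤ : ℕ∞) F) (v : (Fin n → ℝ) × ℝ) :
    Continuous (pderiv' n v F) :=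
  (hF.continuous_fderiv (by simp)).clm_apply continuous_const

theorem pderiv_of_notMem_tsupport {q : (Fin n → ℝ) × ℝ} (hq : q ∉ tsupport F)
    (v : (Fin n → ℝ) × ℝ) : pderiv' n v F q = 0 := by
  rw [pderiv', fderiv_of_notMem_tsupport ℝ hq]
  rfl

theorem tendsto_mul_exp_inv_mul {t : ℝ} (ht : t ≤ 0) :
    Tendsto (fun ε : ℝ => ε * Real.exp (ε⁻¹ * t)) (𝓝[>] 0) (𝓝 0) := by
  refine tendsto_of_tendsto_of_tendsto_of_le_of_le' tendsto_const_nhds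
    (tendsto_id.mono_left nhdsWithin_le_nhds) ?_ ?_ <;>
  filter_upwards [self_mem_nhdsWithin] with ε (hε : 0 < ε)
  · positivity
  · refine mul_le_of_le_one_right hε.le (Real.exp_le_one_iff.mpr ?_)
    exact mul_nonpos_of_nonneg_of_nonpos (inv_nonneg.mpr hε.le) ht

/-- If the profile lives in `t ≤ 0`, only the vertical zeroth-order term survives as `ε → 0`. -/
theorem tendsto_integral_profileGrad (ha : 0 ≤ a) (hp : 0 < p) (hF : ContDiff ℝ (⊤ : ℕ∞) F)
    (hFc : HasCompactSupport F) (hF0 : ∀ q, 0 ≤ F q) (hFt : ∀ q ∈ tsupport F, q.2 ≤ 0) :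
    Tendsto (fun ε => ∫ q, profileGrad n a ε F q ^ p) (𝓝[>] 0)
      (𝓝 (a ^ p * ∫ q, F q ^ p)) := by
  have hFcont := hF.continuous
  have hd := continuous_pderiv hF
  set B : (Fin n → ℝ) × ℝ → ℝ := fun q =>
    √((∑ i, (pderiv' n (ex n i) F q) ^ 2) + (a * F q + |pderiv' n (ey n) F q|) ^ 2) ^ p
  have hBcont : Continuous B := by
    refine Continuous.rpow_const ?_ fun _ => Or.inr hp.le
    fun_prop
  have hBc : HasCompactSupport B := by
    refine HasCompactSupport.intro hFc fun q hq => ?_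
    simp [B, pderiv_of_notMem_tsupport hq, image_eq_zero_of_notMem_tsupport hq,
      Real.zero_rpow hp.ne']
  rw [← integral_const_mul]
  refine tendsto_integral_filter_of_dominated_convergence B ?_ ?_
    (hBcont.integrable_of_hasCompactSupport hBc) ?_
  · refine Eventually.of_forall fun ε => Continuous.aestronglyMeasurable ?_
    refine Continuous.rpow_const ?_ fun _ => Or.inr hp.le
    unfold profileGrad
    fun_prop
  · have h1 : ∀ᶠ ε : ℝ in 𝓝[>] 0, ε < 1 := nhdsWithin_le_nhds (gt_mem_nhds one_pos)
    filter_upwards [self_mem_nhdsWithin, h1] with ε (hε : 0 < ε) hε1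
    refine ae_of_all _ fun q => ?_
    have hG : 0 ≤ profileGrad n a ε F q := Real.sqrt_nonneg _
    rw [Real.norm_of_nonneg (Real.rpow_nonneg hG _)]
    refine Real.rpow_le_rpow hG ?_ hp.le
    by_cases hq : q ∈ tsupport F
    · have hexp : Real.exp (ε⁻¹ * q.2) ≤ 1 := Real.exp_le_one_iff.mpr
        (mul_nonpos_of_nonneg_of_nonpos (inv_nonneg.mpr hε.le) (hFt q hq))
      refine Real.sqrt_le_sqrt (add_le_add (Finset.sum_le_sum fun i _ => ?_) ?_)
      · rw [mul_pow]
        exact mul_le_of_le_one_left (sq_nonneg _)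
          (pow_le_one₀ (by positivity) (mul_le_one₀ hε1.le (Real.exp_pos _).le hexp))
      · refine sq_le_sq.mpr ((abs_add_le _ _).trans ?_)
        have haF : 0 ≤ a * F q := mul_nonneg ha (hF0 q)
        rw [abs_of_nonneg haF, abs_of_nonneg (add_nonneg haF (abs_nonneg _)), abs_mul,
          abs_of_pos hε]
        gcongr
        exact mul_le_of_le_one_left (abs_nonneg _) hε1.le
    · simp [profileGrad, pderiv_of_notMem_tsupport hq, image_eq_zero_of_notMem_tsupport hq]
  · refine ae_of_all _ fun q => ?_
    rw [← Real.mul_rpow ha (hF0 q)]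
    refine Tendsto.rpow_const ?_ (Or.inr hp.le)
    have haF : 0 ≤ a * F q := mul_nonneg ha (hF0 q)
    by_cases hq : q ∈ tsupport F
    · have hid : Tendsto (fun ε : ℝ => ε) (𝓝[>] 0) (𝓝 0) := tendsto_id.mono_left nhdsWithin_le_nhds
      have hlim : Tendsto (fun ε => profileGrad n a ε F q) (𝓝[>] 0)
          (𝓝 √((∑ i : Fin n, (0 * pderiv' n (ex n i) F q) ^ 2) +
            (a * F q + 0 * pderiv' n (ey n) F q) ^ 2)) :=
        ((tendsto_finsetSum _ fun i _ =>
          ((tendsto_mul_exp_inv_mul (hFt q hq)).mul_const _).pow 2).add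
            ((tendsto_const_nhds.add (hid.mul_const _)).pow 2)).sqrt
      simpa [Real.sqrt_sq haF] using hlim
    · simp [profileGrad, pderiv_of_notMem_tsupport hq, image_eq_zero_of_notMem_tsupport hq]

end

theorem exists_contDiff_bump_neg (n : ℕ) :
    ∃ F : (Fin n → ℝ) × ℝ → ℝ, ContDiff ℝ (⊤ : ℕ∞) F ∧ HasCompactSupport F ∧
      (∀ q, 0 ≤ F q) ∧ F ≠ 0 ∧ ∀ q ∈ tsupport F, q.2 ≤ 0 := by
  let b : ContDiffBump ((0, -2) : (Fin n → ℝ) × ℝ) := ⟨1 / 2, 1, by norm_num, by norm_num⟩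
  refine ⟨b, b.contDiff, b.hasCompactSupport, fun q => b.nonneg, fun h => ?_, fun q hq => ?_⟩
  · have h1 : b (0, -2) = 1 := b.one_of_mem_closedBall (Metric.mem_closedBall_self b.rIn_pos.le)
    simp [h] at h1
  · rw [b.tsupport_eq] at hq
    have hdist : dist q.2 (-2) ≤ 1 := (le_max_right _ _).trans hq
    rw [Real.dist_eq] at hdist
    linarith [le_abs_self (q.2 - -2)]

/-- sharpness of the hyperbolic `p`-Poincaré inequality:
for every `c > (n/p)^p` there is a nonzero nonnegative `f ∈ C_c^∞(H)` with
`∫_H ‖∇f‖^p y^{p−n−1} < c · ∫_H f^p y^{−n−1}`. -/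
theorem stmt8 (n : ℕ) (hn : 1 ≤ n) (p : ℝ) (hp : 1 < p)
    (c : ℝ) (hc : ((n : ℝ) / p) ^ p < c) :
    ∃ f : (Fin n → ℝ) × ℝ → ℝ, ContDiff ℝ (⊤ : ℕ∞) f ∧ HasCompactSupport f ∧
      tsupport f ⊆ upperH n ∧ (∀ q, 0 ≤ f q) ∧ f ≠ 0 ∧
      ∫ q in upperH n, Real.sqrt (gradSq n f q) ^ p * q.2 ^ (p - n - 1) <
        c * ∫ q in upperH n, f q ^ p * q.2 ^ (-(n : ℝ) - 1) := by
  have hp0 : 0 < p := one_pos.trans hp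
  obtain ⟨F, hF, hFc, hF0, hFne, hFt⟩ := exists_contDiff_bump_neg n
  have hpos : 0 < ∫ q, F q ^ p := by
    obtain ⟨q, hq⟩ := Function.ne_iff.mp hFne
    have hcont := hF.continuous.rpow_const (p := p) fun _ => Or.inr hp0.le
    refine hcont.integral_pos_of_hasCompactSupport_nonneg_nonzero
      (x := q) (hFc.comp_left (g := fun t => t ^ p) (Real.zero_rpow hp0.ne'))
      (fun r => Real.rpow_nonneg (hF0 r) _) ?_
    exact (Real.rpow_pos_of_pos (lt_of_le_of_ne (hF0 q) (Ne.symm hq)) _).ne'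
  have hlim := tendsto_integral_profileGrad (a := n / p) (by positivity) hp0 hF hFc hF0 hFt
  obtain ⟨ε, hlt, hε⟩ := ((hlim.eventually (gt_mem_nhds (mul_lt_mul_of_pos_right hc hpos))).and
    self_mem_nhdsWithin).exists
  replace hε : 0 < ε := hε
  refine ⟨powerProfile n (n / p) ε F, contDiff_powerProfile hε hFc hF,
    hasCompactSupport_powerProfile hε hFc, tsupport_powerProfile_subset_upperH hε hFc,
    powerProfile_nonneg hF0, powerProfile_ne_zero hε hFne, ?_⟩
  rw [integral_gradSq_powerProfile hε hp0 (hF.differentiable (by simp)),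
    integral_powerProfile hε hp0 hF0, mul_left_comm]
  exact mul_lt_mul_of_pos_left hlt (by positivity)
end

section
/- Let n ≥ 1 and define the hyperbolic Laplacian L on functions on H = ℝ^n × (0, ∞) by (Lf)(x,y) = y²·(Δf)(x,y) − (n−1)·y·(∂_y f)(x,y). For every real c > n²/4 there exists a nonzero smooth function f : ℝ^n × ℝ → ℝ with compact support contained in H such that ∫_H (Lf)(x,y)² · y^{−n−1} dx dy < c · ∫_H ‖∇f(x,y)‖² · y^{1−n} dx dy. -/
open MeasureTheory

open Filter Topology Set

/-- The sum of the second partial derivatives on `ℝ^n`. -/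
noncomputable def horizLap {n : ℕ} (g : (Fin n → ℝ) → ℝ) (x : Fin n → ℝ) : ℝ :=
  ∑ i, fderiv ℝ (fun z => fderiv ℝ g z (Pi.single i 1)) x (Pi.single i 1)

/-- The hyperbolic Laplacian applied to a function of `y` only. -/
noncomputable def vertLap (n : ℕ) (u : ℝ → ℝ) (y : ℝ) : ℝ :=
  y ^ 2 * deriv (deriv u) y - ((n : ℝ) - 1) * y * deriv u y

lemma HasCompactSupport.sq_real {X : Type*} [TopologicalSpace X] {f : X → ℝ}
    (hc : HasCompactSupport f) : HasCompactSupport fun x => f x ^ 2 :=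
  hc.mono fun x hx h => hx (by simp [h])

lemma integrable_sq_of_hasCompactSupport {X : Type*} [TopologicalSpace X] [MeasurableSpace X]
    [OpensMeasurableSpace X] {μ : Measure X} [IsFiniteMeasureOnCompacts μ] {f : X → ℝ}
    (hf : Continuous f) (hc : HasCompactSupport f) : Integrable (fun x => f x ^ 2) μ :=
  Continuous.integrable_of_hasCompactSupport (hf.pow 2) hc.sq_real

section Calculus

variable {E F : Type*} [NormedAddCommGroup E] [NormedSpace ℝ E]
  [NormedAddCommGroup F] [NormedSpace ℝ F]

lemma contDiff_fderiv_apply_const {g : E → F} (hg : ContDiff ℝ (⊤ : ℕ∞) g) (v : E) :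
    ContDiff ℝ (⊤ : ℕ∞) (fun x => fderiv ℝ g x v) :=
  (hg.fderiv_right (m := (⊤ : ℕ∞)) (by simp)).clm_apply contDiff_const

lemma contDiff_deriv_of_smooth {u : ℝ → F} (hu : ContDiff ℝ (⊤ : ℕ∞) u) :
    ContDiff ℝ (⊤ : ℕ∞) (deriv u) := by
  simpa only [fderiv_apply_one_eq_deriv] using contDiff_fderiv_apply_const hu 1

lemma fderiv_comp_smul_apply {g : E → ℝ} (hg : Differentiable ℝ g) (δ : ℝ) (x v : E) :
    fderiv ℝ (fun z => g (δ • z)) x v = δ * fderiv ℝ g (δ • x) v := by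
  have h : HasFDerivAt (fun z => g (δ • z))
      ((fderiv ℝ g (δ • x)).comp (δ • ContinuousLinearMap.id ℝ E)) x :=
    (hg (δ • x)).hasFDerivAt.comp x ((hasFDerivAt_id x).const_smul δ)
  rw [h.fderiv]
  simp

lemma fderiv_mul_fst_snd_apply {g : E → ℝ} {u : ℝ → ℝ} (hg : Differentiable ℝ g)
    (hu : Differentiable ℝ u) (p v : E × ℝ) :
    fderiv ℝ (fun q : E × ℝ => g q.1 * u q.2) p v =
      fderiv ℝ g p.1 v.1 * u p.2 + g p.1 * (deriv u p.2 * v.2) := by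
  have h1 : HasFDerivAt (fun q : E × ℝ => g q.1)
      ((fderiv ℝ g p.1).comp (ContinuousLinearMap.fst ℝ E ℝ)) p :=
    (hg p.1).hasFDerivAt.comp p hasFDerivAt_fst
  have h2 : HasFDerivAt (fun q : E × ℝ => u q.2)
      ((fderiv ℝ u p.2).comp (ContinuousLinearMap.snd ℝ E ℝ)) p :=
    (hu p.2).hasFDerivAt.comp p hasFDerivAt_snd
  rw [(h1.fun_mul h2).fderiv]
  have h3 : fderiv ℝ u p.2 v.2 = v.2 * deriv u p.2 := by
    simp
  simp [h3]
  ring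

end Calculus

section Product

variable {n : ℕ} {g : (Fin n → ℝ) → ℝ} {u : ℝ → ℝ}

lemma pderiv'_ex_mul (hg : Differentiable ℝ g) (hu : Differentiable ℝ u) (i : Fin n) :
    pderiv' n (ex n i) (fun q => g q.1 * u q.2) =
      fun q => fderiv ℝ g q.1 (Pi.single i 1) * u q.2 := by
  funext p
  simp [pderiv', ex, fderiv_mul_fst_snd_apply hg hu]

lemma pderiv'_ey_mul (hg : Differentiable ℝ g) (hu : Differentiable ℝ u) :
    pderiv' n (ey n) (fun q => g q.1 * u q.2) = fun q => g q.1 * deriv u q.2 := by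
  funext p
  simp [pderiv', ey, fderiv_mul_fst_snd_apply hg hu]

lemma hypLap_mul (hg : ContDiff ℝ (⊤ : ℕ∞) g) (hu : ContDiff ℝ (⊤ : ℕ∞) u)
    (q : (Fin n → ℝ) × ℝ) :
    hypLap n (fun q => g q.1 * u q.2) q =
      g q.1 * vertLap n u q.2 + horizLap g q.1 * (q.2 ^ 2 * u q.2) := by
  have hg' := hg.differentiable (by simp)
  have hu' := hu.differentiable (by simp)
  have h2 : ∀ i, pderiv' n (ex n i) (pderiv' n (ex n i) fun q => g q.1 * u q.2) q =
      fderiv ℝ (fun z => fderiv ℝ g z (Pi.single i 1)) q.1 (Pi.single i 1) * u q.2 := by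
    intro i
    rw [pderiv'_ex_mul hg' hu',
      pderiv'_ex_mul ((contDiff_fderiv_apply_const hg _).differentiable (by simp)) hu']
  simp only [hypLap, eucLap, h2]
  rw [pderiv'_ey_mul hg' hu',
    pderiv'_ey_mul hg' ((contDiff_deriv_of_smooth hu).differentiable (by simp)),
    ← Finset.sum_mul, vertLap, horizLap]
  ring

lemma gradSq_mul (hg : ContDiff ℝ (⊤ : ℕ∞) g) (hu : ContDiff ℝ (⊤ : ℕ∞) u)
    (q : (Fin n → ℝ) × ℝ) :
    gradSq n (fun q => g q.1 * u q.2) q =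
      (∑ i, (fderiv ℝ g q.1 (Pi.single i 1)) ^ 2) * u q.2 ^ 2 + g q.1 ^ 2 * deriv u q.2 ^ 2 := by
  have hg' := hg.differentiable (by simp)
  have hu' := hu.differentiable (by simp)
  simp only [gradSq, pderiv'_ex_mul hg' hu', pderiv'_ey_mul hg' hu', mul_pow, ← Finset.sum_mul]

end Product

section HorizLap

variable {n : ℕ} {g : (Fin n → ℝ) → ℝ}

lemma continuous_horizLap (hg : ContDiff ℝ (⊤ : ℕ∞) g) : Continuous (horizLap g) :=
  continuous_finsetSum _ fun i _ =>
    (contDiff_fderiv_apply_const (contDiff_fderiv_apply_const hg (Pi.single i 1))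
      (Pi.single i 1)).continuous

lemma tsupport_horizLap_subset : tsupport (horizLap g) ⊆ tsupport g := by
  refine closure_minimal (fun x hx => ?_) (isClosed_tsupport g)
  by_contra hxg
  refine hx (Finset.sum_eq_zero fun i _ => ?_)
  have h1 : x ∉ tsupport fun z => fderiv ℝ g z (Pi.single i 1) :=
    fun h => hxg (tsupport_fderiv_apply_subset ℝ (Pi.single i 1) h)
  exact image_eq_zero_of_notMem_tsupport
    (f := fun z => fderiv ℝ (fun w => fderiv ℝ g w (Pi.single i 1)) z (Pi.single i 1))
    fun h => h1 (tsupport_fderiv_apply_subset ℝ (Pi.single i 1) h)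

lemma horizLap_comp_smul (hg : ContDiff ℝ (⊤ : ℕ∞) g) (δ : ℝ) (x : Fin n → ℝ) :
    horizLap (fun z => g (δ • z)) x = δ ^ 2 * horizLap g (δ • x) := by
  simp only [horizLap, Finset.mul_sum]
  refine Finset.sum_congr rfl fun i _ => ?_
  have h1 := hg.differentiable (by simp)
  have h2 := (contDiff_fderiv_apply_const hg (Pi.single i 1)).differentiable (by simp)
  simp only [fderiv_comp_smul_apply h1]
  rw [fderiv_const_mul (by fun_prop)]
  simp only [smul_apply, smul_eq_mul]
  rw [fderiv_comp_smul_apply h2]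
  ring

/-- Rescaling a bump function makes its Laplacian negligible. -/
lemma exists_horizLap_small (n : ℕ) (M N : ℝ) {ε : ℝ} (hε : 0 < ε) :
    ∃ g : (Fin n → ℝ) → ℝ, ContDiff ℝ (⊤ : ℕ∞) g ∧ HasCompactSupport g ∧
      2 * (∫ x, g x * horizLap g x) * M + (∫ x, horizLap g x ^ 2) * N < ε * ∫ x, g x ^ 2 := by
  obtain ⟨ψ, -, hψc, hψ, -, hψ0⟩ :=
    exists_contDiff_tsupport_subset (n := (⊤ : ℕ∞)) (s := univ) (x := (0 : Fin n → ℝ)) univ_mem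
  have hpos : 0 < ∫ x, ψ x ^ 2 := by
    refine Continuous.integral_pos_of_hasCompactSupport_nonneg_nonzero (x := 0)
      (hψ.continuous.pow 2) hψc.sq_real (fun x => sq_nonneg _) (by simp [hψ0])
  set a := ∫ x, ψ x ^ 2
  set b := ∫ x, ψ x * horizLap ψ x with hb
  set d := ∫ x, horizLap ψ x ^ 2 with hd
  have hlim : Tendsto (fun δ : ℝ => 2 * (δ ^ 2 * b) * M + δ ^ 4 * d * N) (𝓝[>] 0) (𝓝 0) := by
    have : Continuous (fun δ : ℝ => 2 * (δ ^ 2 * b) * M + δ ^ 4 * d * N) := by fun_prop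
    simpa using (this.tendsto 0).mono_left nhdsWithin_le_nhds
  obtain ⟨δ, hδ, hδ0⟩ := ((hlim.eventually (gt_mem_nhds (mul_pos hε hpos))).and
    self_mem_nhdsWithin).exists
  replace hδ0 : 0 < δ := hδ0
  refine ⟨fun x => ψ (δ • x), hψ.comp (contDiff_id.const_smul δ), hψc.comp_smul hδ0.ne', ?_⟩
  have hscale : ∀ h : (Fin n → ℝ) → ℝ, ∫ x, h (δ • x) = |(δ ^ n)⁻¹| * ∫ x, h x := fun h => by
    simpa using Measure.integral_comp_smul volume h δ
  have e1 : ∫ x, ψ (δ • x) * (δ ^ 2 * horizLap ψ (δ • x)) = |(δ ^ n)⁻¹| * (δ ^ 2 * b) := by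
    rw [hscale fun x => ψ x * (δ ^ 2 * horizLap ψ x), hb, ← integral_const_mul (δ ^ 2)]
    simp only [mul_left_comm]
  have e2 : ∫ x, (δ ^ 2 * horizLap ψ (δ • x)) ^ 2 = |(δ ^ n)⁻¹| * (δ ^ 4 * d) := by
    rw [hscale fun x => (δ ^ 2 * horizLap ψ x) ^ 2, hd, ← integral_const_mul (δ ^ 4)]
    simp only [mul_pow, ← pow_mul]
  simp only [horizLap_comp_smul hψ]
  rw [e1, e2, hscale fun x => ψ x ^ 2]
  have hp : 0 < |(δ ^ n)⁻¹| := by positivity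
  calc _ = |(δ ^ n)⁻¹| * (2 * (δ ^ 2 * b) * M + δ ^ 4 * d * N) := by ring
    _ < |(δ ^ n)⁻¹| * (ε * a) := mul_lt_mul_of_pos_left hδ hp
    _ = _ := by ring

end HorizLap

section OneDim

lemma tsupport_deriv_subset_tsupport {u : ℝ → ℝ} : tsupport (deriv u) ⊆ tsupport u :=
  closure_minimal support_deriv_subset (isClosed_tsupport u)

lemma integrableOn_mul_rpow {h : ℝ → ℝ} {K : Set ℝ} (hc : Continuous h) (hK : IsCompact K)
    (hK0 : K ⊆ Ioi 0) (hs : ∀ y ∉ K, h y = 0) (α : ℝ) :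
    Integrable (fun y => h y * y ^ α) (volume.restrict (Ioi 0)) := by
  have hsub : tsupport (fun y => h y * y ^ α) ⊆ K := by
    refine closure_minimal (fun y hy => ?_) hK.isClosed
    by_contra hyK
    exact hy (by simp [hs y hyK])
  have hcont : ContinuousOn (fun y => h y * y ^ α) (Ioi 0) :=
    hc.continuousOn.mul (continuousOn_id.rpow_const fun y hy => Or.inl (ne_of_gt hy))
  exact ((hcont.continuous_of_tsupport_subset isOpen_Ioi
    (hsub.trans hK0)).integrable_of_hasCompactSupport
      (hK.of_isClosed_subset (isClosed_tsupport _) hsub)).restrict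

lemma integral_Ioi_eq_integral_exp (g : ℝ → ℝ) :
    ∫ y in Ioi 0, g y = ∫ t, Real.exp t * g (Real.exp t) := by
  have := integral_image_eq_integral_abs_deriv_smul (s := univ) MeasurableSet.univ
    (fun t _ => (Real.hasDerivAt_exp t).hasDerivWithinAt) Real.exp_injective.injOn g
  simpa [image_univ, Real.range_exp] using this

/-- Transport of a function on `ℝ` to the half-line by the logarithm. -/
noncomputable def logTransport (v : ℝ → ℝ) (y : ℝ) : ℝ := if 0 < y then v (Real.log y) else 0

variable {v : ℝ → ℝ}

lemma tsupport_logTransport_subset (hc : HasCompactSupport v) :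
    tsupport (logTransport v) ⊆ Real.exp '' tsupport v := by
  refine closure_minimal (fun y hy => ?_)
    (hc.isCompact.image Real.continuous_exp).isClosed
  have hy0 : 0 < y := by
    by_contra h
    exact hy (by simp [logTransport, h])
  refine ⟨Real.log y, subset_tsupport v fun h => hy (by simp [logTransport, h]), Real.exp_log hy0⟩

lemma tsupport_logTransport_subset_Ioi (hc : HasCompactSupport v) :
    tsupport (logTransport v) ⊆ Ioi 0 := by
  refine (tsupport_logTransport_subset hc).trans ?_
  rintro _ ⟨t, -, rfl⟩
  exact Real.exp_pos t

lemma hasCompactSupport_logTransport (hc : HasCompactSupport v) :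
    HasCompactSupport (logTransport v) :=
  (hc.isCompact.image Real.continuous_exp).of_isClosed_subset (isClosed_tsupport _)
    (tsupport_logTransport_subset hc)

lemma logTransport_eventuallyEq {y : ℝ} (hy : 0 < y) :
    logTransport v =ᶠ[𝓝 y] fun z => v (Real.log z) := by
  filter_upwards [lt_mem_nhds hy] with z hz
  simp [logTransport, hz]

lemma contDiff_logTransport (hv : ContDiff ℝ (⊤ : ℕ∞) v) (hc : HasCompactSupport v) :
    ContDiff ℝ (⊤ : ℕ∞) (logTransport v) := by
  refine contDiff_iff_contDiffAt.2 fun y => ?_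
  by_cases hy : 0 < y
  · exact ((hv.contDiffAt).comp y (Real.contDiffAt_log.2 hy.ne')).congr_of_eventuallyEq
      (logTransport_eventuallyEq hy)
  · have : y ∉ tsupport (logTransport v) := fun h => hy (tsupport_logTransport_subset_Ioi hc h)
    exact contDiffAt_const.congr_of_eventuallyEq (notMem_tsupport_iff_eventuallyEq.1 this)

lemma deriv_logTransport (hv : Differentiable ℝ v) {y : ℝ} (hy : 0 < y) :
    deriv (logTransport v) y = deriv v (Real.log y) / y := by
  rw [(logTransport_eventuallyEq hy).deriv_eq]
  exact ((hv _).hasDerivAt.comp y (Real.hasDerivAt_log hy.ne')).deriv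

lemma deriv_deriv_logTransport (hv : ContDiff ℝ (⊤ : ℕ∞) v) {y : ℝ} (hy : 0 < y) :
    deriv (deriv (logTransport v)) y =
      (deriv (deriv v) (Real.log y) - deriv v (Real.log y)) / y ^ 2 := by
  have h : deriv (logTransport v) =ᶠ[𝓝 y] fun z => deriv v (Real.log z) / z := by
    filter_upwards [lt_mem_nhds hy] with z hz
    exact deriv_logTransport (hv.differentiable (by simp)) hz
  rw [h.deriv_eq]
  have h1 := ((contDiff_deriv_of_smooth hv).differentiable (by simp)
    (Real.log y)).hasDerivAt.comp y (Real.hasDerivAt_log hy.ne')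
  rw [(HasDerivAt.fun_div (c := fun z => deriv v (Real.log z)) h1 (hasDerivAt_id' y) hy.ne').deriv]
  field_simp

lemma integral_vertLap_logTransport (n : ℕ) (hv : ContDiff ℝ (⊤ : ℕ∞) v) :
    ∫ y in Ioi 0, vertLap n (logTransport v) y ^ 2 * y ^ (-(n : ℝ) - 1) =
      ∫ t, (deriv (deriv v) t - n * deriv v t) ^ 2 * Real.exp (-(n * t)) := by
  rw [integral_Ioi_eq_integral_exp]
  congr 1
  funext t
  have ht := Real.exp_pos t
  have e : Real.exp t * Real.exp t ^ (-(n : ℝ) - 1) = Real.exp (-(n * t)) := by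
    rw [← Real.exp_mul, ← Real.exp_add]
    ring_nf
  rw [vertLap, deriv_logTransport (hv.differentiable (by simp)) ht,
    deriv_deriv_logTransport hv ht, Real.log_exp, ← e]
  field_simp
  ring

lemma integral_deriv_logTransport (n : ℕ) (hv : ContDiff ℝ (⊤ : ℕ∞) v) :
    ∫ y in Ioi 0, deriv (logTransport v) y ^ 2 * y ^ (1 - (n : ℝ)) =
      ∫ t, deriv v t ^ 2 * Real.exp (-(n * t)) := by
  rw [integral_Ioi_eq_integral_exp]
  congr 1
  funext t
  have ht := Real.exp_pos t
  have e : Real.exp t ^ (1 - (n : ℝ)) = Real.exp t * Real.exp (-(n * t)) := by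
    rw [← Real.exp_mul, ← Real.exp_add]
    ring_nf
  rw [deriv_logTransport (hv.differentiable (by simp)) ht, Real.log_exp, e]
  field_simp

lemma tendsto_integral_sq_add_mul {p q : ℝ → ℝ} (hp : Continuous p) (hq : Continuous q)
    (hpc : HasCompactSupport p) (hqc : HasCompactSupport q) :
    Tendsto (fun r : ℝ => ∫ t, (p t + r * q t) ^ 2) (𝓝 0) (𝓝 (∫ t, p t ^ 2)) := by
  have i1 : Integrable fun t => p t ^ 2 :=
    integrable_sq_of_hasCompactSupport hp hpc
  have i2 : Integrable fun t => p t * q t :=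
    (hp.mul hq).integrable_of_hasCompactSupport hqc.mul_left
  have i3 : Integrable fun t => q t ^ 2 :=
    integrable_sq_of_hasCompactSupport hq hqc
  have e : ∀ r : ℝ, ∫ t, (p t + r * q t) ^ 2 =
      (∫ t, p t ^ 2) + 2 * r * (∫ t, p t * q t) + r ^ 2 * ∫ t, q t ^ 2 := fun r => by
    rw [← integral_const_mul, ← integral_const_mul, ← integral_add i1 (i2.const_mul _),
      ← integral_add (i1.fun_add (i2.const_mul _)) (i3.const_mul _)]
    congr 1
    funext t
    ring
  simp only [e]
  have : Continuous fun r : ℝ =>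
      (∫ t, p t ^ 2) + 2 * r * (∫ t, p t * q t) + r ^ 2 * ∫ t, q t ^ 2 := by fun_prop
  simpa using this.tendsto 0

/-- The one-dimensional buckling inequality for slowly varying functions. -/
lemma exists_integral_sq_lt {s c : ℝ} (hs : s ≠ 0) (hc : s ^ 2 < c) :
    ∃ χ : ℝ → ℝ, ContDiff ℝ (⊤ : ℕ∞) χ ∧ HasCompactSupport χ ∧
      ∫ t, (deriv (deriv χ) t - s ^ 2 * χ t) ^ 2 < c * ∫ t, (deriv χ t + s * χ t) ^ 2 := by
  obtain ⟨η, -, hηc, hη, -, hη0⟩ :=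
    exists_contDiff_tsupport_subset (n := (⊤ : ℕ∞)) (s := univ) (x := (0 : ℝ)) univ_mem
  have hpos : 0 < ∫ t, η t ^ 2 := by
    refine Continuous.integral_pos_of_hasCompactSupport_nonneg_nonzero (x := 0)
      (hη.continuous.pow 2) hηc.sq_real (fun x => sq_nonneg _) (by simp [hη0])
  have hη1 := contDiff_deriv_of_smooth hη
  have hη2 := contDiff_deriv_of_smooth hη1
  have hη1c : HasCompactSupport (deriv η) := hηc.deriv
  have hη2c : HasCompactSupport (deriv (deriv η)) := hη1c.deriv
  have hsq : Tendsto (fun r : ℝ => r ^ 2) (𝓝[>] 0) (𝓝 0) := by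
    simpa using ((continuous_pow 2).tendsto (0 : ℝ)).mono_left nhdsWithin_le_nhds
  have hmul : ∀ a : ℝ, Continuous (fun t => a * η t) ∧ HasCompactSupport fun t => a * η t :=
    fun a => ⟨continuous_const.mul hη.continuous, hηc.mono fun t ht h => ht (by simp [h])⟩
  have hL : Tendsto (fun r : ℝ => ∫ t, (-s ^ 2 * η t + r ^ 2 * deriv (deriv η) t) ^ 2) (𝓝[>] 0)
      (𝓝 (∫ t, (-s ^ 2 * η t) ^ 2)) :=
    (tendsto_integral_sq_add_mul (hmul _).1 hη2.continuous (hmul _).2 hη2c).comp hsq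
  have hR : Tendsto (fun r : ℝ => c * ∫ t, (s * η t + r * deriv η t) ^ 2) (𝓝[>] 0)
      (𝓝 (c * ∫ t, (s * η t) ^ 2)) :=
    ((tendsto_integral_sq_add_mul (hmul _).1 hη1.continuous (hmul _).2 hη1c).mono_left
      nhdsWithin_le_nhds).const_mul c
  have hlt : ∫ t, (-s ^ 2 * η t) ^ 2 < c * ∫ t, (s * η t) ^ 2 := by
    simp only [mul_pow, integral_const_mul]
    have : 0 < s ^ 2 := by positivity
    nlinarith [mul_lt_mul_of_pos_right hc (mul_pos this hpos)]
  obtain ⟨r, hr, hr0⟩ := ((hL.eventually_lt hR hlt).and self_mem_nhdsWithin).exists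
  replace hr0 : 0 < r := hr0
  have hd : ∀ {h : ℝ → ℝ} (t : ℝ), deriv (fun t => h (r * t)) t = r * deriv h (r * t) :=
    fun {h} t => deriv_comp_mul_left r h t
  refine ⟨fun t => η (r * t), hη.comp (contDiff_const.mul contDiff_id),
    hηc.comp_homeomorph (Homeomorph.mulLeft₀ r hr0.ne'), ?_⟩
  have e1 : deriv (fun t => η (r * t)) = fun t => r * deriv η (r * t) := funext hd
  have e2 : deriv (deriv fun t => η (r * t)) = fun t => r ^ 2 * deriv (deriv η) (r * t) := by
    funext t
    rw [e1, deriv_const_mul_field, hd]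
    ring
  rw [e2, e1]
  have c1 : ∫ t, (r ^ 2 * deriv (deriv η) (r * t) - s ^ 2 * η (r * t)) ^ 2 =
      |r⁻¹| * ∫ t, (-s ^ 2 * η t + r ^ 2 * deriv (deriv η) t) ^ 2 := by
    rw [← smul_eq_mul, ← Measure.integral_comp_mul_left]
    congr 1
    funext t
    ring
  have c2 : ∫ t, (r * deriv η (r * t) + s * η (r * t)) ^ 2 =
      |r⁻¹| * ∫ t, (s * η t + r * deriv η t) ^ 2 := by
    rw [← smul_eq_mul, ← Measure.integral_comp_mul_left]
    congr 1
    funext t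
    ring
  rw [c1, c2, mul_left_comm]
  exact mul_lt_mul_of_pos_left hr (by positivity)

/-- The buckling inequality for functions of the height only. -/
lemma exists_integral_vertLap_lt {n : ℕ} (hn : 1 ≤ n) {c : ℝ} (hc : (n : ℝ) ^ 2 / 4 < c) :
    ∃ u : ℝ → ℝ, ContDiff ℝ (⊤ : ℕ∞) u ∧ HasCompactSupport u ∧ tsupport u ⊆ Ioi 0 ∧
      ∫ y in Ioi 0, vertLap n u y ^ 2 * y ^ (-(n : ℝ) - 1) <
        c * ∫ y in Ioi 0, deriv u y ^ 2 * y ^ (1 - (n : ℝ)) := by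
  have hn0 : (n : ℝ) ≠ 0 := by positivity
  obtain ⟨χ, hχ, hχc, hlt⟩ := exists_integral_sq_lt (s := (n : ℝ) / 2) (c := c)
    (by positivity) (by linarith [hc, (by ring : ((n : ℝ) / 2) ^ 2 = (n : ℝ) ^ 2 / 4)])
  set s : ℝ := (n : ℝ) / 2 with hs
  have hns : (n : ℝ) = 2 * s := by rw [hs]; ring
  have hχ1 := contDiff_deriv_of_smooth hχ
  have hE : ∀ t, HasDerivAt (fun t => Real.exp (s * t)) (Real.exp (s * t) * s) t := fun t => by
    simpa using ((hasDerivAt_id t).const_mul s).exp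
  have hD : ∀ {h : ℝ → ℝ}, Differentiable ℝ h → deriv (fun t => Real.exp (s * t) * h t) =
      fun t => Real.exp (s * t) * (deriv h t + s * h t) := fun {h} hh => by
    funext t
    rw [((hE t).fun_mul (hh t).hasDerivAt).deriv]
    ring
  have hχd := hχ.differentiable (by simp)
  have hχ1d := hχ1.differentiable (by simp)
  have hv : ContDiff ℝ (⊤ : ℕ∞) (fun t => Real.exp (s * t) * χ t) :=
    (Real.contDiff_exp.comp (contDiff_const.mul contDiff_id)).mul hχ
  have hvc : HasCompactSupport (fun t => Real.exp (s * t) * χ t) := hχc.mul_left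
  refine ⟨logTransport fun t => Real.exp (s * t) * χ t, contDiff_logTransport hv hvc,
    hasCompactSupport_logTransport hvc, tsupport_logTransport_subset_Ioi hvc, ?_⟩
  rw [integral_vertLap_logTransport n hv, integral_deriv_logTransport n hv, hD hχd,
    hD (hχ1d.fun_add (hχd.const_mul s))]
  have hexp : ∀ t, Real.exp (s * t) ^ 2 * Real.exp (-(n * t)) = 1 := fun t => by
    rw [← Real.exp_nat_mul, ← Real.exp_add, hns]
    simp [mul_assoc]
  convert hlt using 4 with t t
  · beta_reduce
    rw [deriv_fun_add (hχ1d t) ((hχd t).const_mul s), deriv_const_mul_field]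
    rw [← one_mul ((deriv (deriv χ) t - s ^ 2 * χ t) ^ 2), ← hexp t, hns]
    ring
  · rw [← one_mul ((deriv χ t + s * χ t) ^ 2), ← hexp t]
    ring

end OneDim

section Energy

variable {n : ℕ} {g : (Fin n → ℝ) → ℝ} {u : ℝ → ℝ}

lemma volume_restrict_upperH (n : ℕ) :
    (volume : Measure ((Fin n → ℝ) × ℝ)).restrict (upperH n) =
      (volume : Measure (Fin n → ℝ)).prod (volume.restrict (Ioi 0)) := by
  have : upperH n = univ ×ˢ Ioi (0 : ℝ) := by
    ext p
    simp [upperH]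
  rw [this, Measure.volume_eq_prod, ← Measure.prod_restrict, Measure.restrict_univ]

lemma integral_hypLap_mul (hg : ContDiff ℝ (⊤ : ℕ∞) g) (hgc : HasCompactSupport g)
    (hu : ContDiff ℝ (⊤ : ℕ∞) u) (huc : HasCompactSupport u) (hu0 : tsupport u ⊆ Ioi 0) (α : ℝ) :
    ∫ q in upperH n, hypLap n (fun q => g q.1 * u q.2) q ^ 2 * q.2 ^ α =
      (∫ x, g x ^ 2) * (∫ y in Ioi 0, vertLap n u y ^ 2 * y ^ α) +
      2 * (∫ x, g x * horizLap g x) *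
        (∫ y in Ioi 0, vertLap n u y * (y ^ 2 * u y) * y ^ α) +
      (∫ x, horizLap g x ^ 2) * (∫ y in Ioi 0, (y ^ 2 * u y) ^ 2 * y ^ α) := by
  have hgcont := hg.continuous
  have hlap := continuous_horizLap hg
  have hlapc : HasCompactSupport (horizLap g) :=
    hgc.of_isClosed_subset (isClosed_tsupport _) tsupport_horizLap_subset
  have hucont := hu.continuous
  have hu1 := (contDiff_deriv_of_smooth hu).continuous
  have hu2 := (contDiff_deriv_of_smooth (contDiff_deriv_of_smooth hu)).continuous
  have hvert : Continuous (vertLap n u) := by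
    unfold vertLap
    fun_prop
  have hz : ∀ y ∉ tsupport u, u y = 0 := fun y hy => image_eq_zero_of_notMem_tsupport hy
  have hzv : ∀ y ∉ tsupport u, vertLap n u y = 0 := fun y hy => by
    have h1 : y ∉ tsupport (deriv u) := fun h => hy (tsupport_deriv_subset_tsupport h)
    have h2 : y ∉ tsupport (deriv (deriv u)) := fun h => h1 (tsupport_deriv_subset_tsupport h)
    simp [vertLap, image_eq_zero_of_notMem_tsupport h1, image_eq_zero_of_notMem_tsupport h2]
  have i1 : Integrable fun x => g x ^ 2 :=
    integrable_sq_of_hasCompactSupport hgcont hgc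
  have i2 : Integrable fun x => g x * horizLap g x :=
    (hgcont.mul hlap).integrable_of_hasCompactSupport hlapc.mul_left
  have i3 : Integrable fun x => horizLap g x ^ 2 :=
    integrable_sq_of_hasCompactSupport hlap hlapc
  have j1 := integrableOn_mul_rpow (h := fun y => vertLap n u y ^ 2) (by fun_prop)
    huc hu0 (fun y hy => by simp [hzv y hy]) α
  have j2 := integrableOn_mul_rpow (h := fun y => vertLap n u y * (y ^ 2 * u y)) (by fun_prop)
    huc hu0 (fun y hy => by simp [hz y hy]) α
  have j3 := integrableOn_mul_rpow (h := fun y => (y ^ 2 * u y) ^ 2) (by fun_prop)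
    huc hu0 (fun y hy => by simp [hz y hy]) α
  rw [volume_restrict_upperH, mul_assoc 2, ← integral_prod_mul, ← integral_prod_mul,
    ← integral_prod_mul, ← integral_const_mul,
    ← integral_add (i1.mul_prod j1) ((i2.mul_prod j2).const_mul 2),
    ← integral_add ((i1.mul_prod j1).fun_add ((i2.mul_prod j2).const_mul 2)) (i3.mul_prod j3)]
  congr 1
  funext q
  rw [hypLap_mul hg hu]
  ring

lemma le_integral_gradSq_mul (hg : ContDiff ℝ (⊤ : ℕ∞) g) (hgc : HasCompactSupport g)
    (hu : ContDiff ℝ (⊤ : ℕ∞) u) (huc : HasCompactSupport u) (hu0 : tsupport u ⊆ Ioi 0) (α : ℝ) :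
    (∫ x, g x ^ 2) * (∫ y in Ioi 0, deriv u y ^ 2 * y ^ α) ≤
      ∫ q in upperH n, gradSq n (fun q => g q.1 * u q.2) q * q.2 ^ α := by
  have hgcont := hg.continuous
  have hucont := hu.continuous
  have hu1 := (contDiff_deriv_of_smooth hu).continuous
  have i1 : Integrable fun x => g x ^ 2 :=
    integrable_sq_of_hasCompactSupport hgcont hgc
  have i2 : Integrable fun x => ∑ i, (fderiv ℝ g x (Pi.single i 1)) ^ 2 := by
    refine integrable_finsetSum _ fun i _ => ?_
    have h1 := (contDiff_fderiv_apply_const hg (Pi.single i 1)).continuous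
    exact integrable_sq_of_hasCompactSupport h1 (hgc.fderiv_apply ℝ (Pi.single i 1))
  have j1 := integrableOn_mul_rpow (h := fun y => deriv u y ^ 2) (by fun_prop)
    huc hu0 (fun y hy => by
      simp [image_eq_zero_of_notMem_tsupport fun h => hy (tsupport_deriv_subset_tsupport h)]) α
  have j2 := integrableOn_mul_rpow (h := fun y => u y ^ 2) (by fun_prop)
    huc hu0 (fun y hy => by simp [image_eq_zero_of_notMem_tsupport hy]) α
  have e : ∫ q in upperH n, gradSq n (fun q => g q.1 * u q.2) q * q.2 ^ α =
      (∫ x, ∑ i, (fderiv ℝ g x (Pi.single i 1)) ^ 2) * (∫ y in Ioi 0, u y ^ 2 * y ^ α) +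
        (∫ x, g x ^ 2) * (∫ y in Ioi 0, deriv u y ^ 2 * y ^ α) := by
    rw [volume_restrict_upperH, ← integral_prod_mul, ← integral_prod_mul,
      ← integral_add (i2.mul_prod j2) (i1.mul_prod j1)]
    congr 1
    funext q
    rw [gradSq_mul hg hu]
    ring
  rw [e]
  refine le_add_of_nonneg_left (mul_nonneg
    (integral_nonneg fun x => Finset.sum_nonneg fun i _ => sq_nonneg _)
    (setIntegral_nonneg measurableSet_Ioi fun y hy => ?_))
  exact mul_nonneg (sq_nonneg _) (Real.rpow_nonneg (le_of_lt hy) _)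

end Energy

/-- sharpness of the buckling bound on hyperbolic space:
for every `c > n²/4` there is a nonzero `f ∈ C_c^∞(H)` with
`∫_H (Lf)² y^{−n−1} < c · ∫_H ‖∇f‖² y^{1−n}`. -/
theorem stmt12 (n : ℕ) (hn : 1 ≤ n) (c : ℝ) (hc : (n : ℝ) ^ 2 / 4 < c) :
    ∃ f : (Fin n → ℝ) × ℝ → ℝ, ContDiff ℝ (⊤ : ℕ∞) f ∧ HasCompactSupport f ∧
      tsupport f ⊆ upperH n ∧ f ≠ 0 ∧
      ∫ q in upperH n, (hypLap n f q) ^ 2 * q.2 ^ (-(n : ℝ) - 1) <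
        c * ∫ q in upperH n, gradSq n f q * q.2 ^ (1 - (n : ℝ)) := by
  have hc0 : 0 < c := lt_of_le_of_lt (by positivity) hc
  obtain ⟨u, hu, huc, hu0, hlt⟩ := exists_integral_vertLap_lt hn hc
  obtain ⟨g, hg, hgc, hsmall⟩ := exists_horizLap_small n
    (∫ y in Ioi 0, vertLap n u y * (y ^ 2 * u y) * y ^ (-(n : ℝ) - 1))
    (∫ y in Ioi 0, (y ^ 2 * u y) ^ 2 * y ^ (-(n : ℝ) - 1)) (sub_pos.2 hlt)
  have hmain : ∫ q in upperH n,
      (hypLap n (fun q => g q.1 * u q.2) q) ^ 2 * q.2 ^ (-(n : ℝ) - 1) <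
        c * ∫ q in upperH n, gradSq n (fun q => g q.1 * u q.2) q * q.2 ^ (1 - (n : ℝ)) := by
    refine lt_of_lt_of_le ?_
      (mul_le_mul_of_nonneg_left (le_integral_gradSq_mul hg hgc hu huc hu0 _) hc0.le)
    rw [integral_hypLap_mul hg hgc hu huc hu0]
    linarith
  have hsub : tsupport (fun q : (Fin n → ℝ) × ℝ => g q.1 * u q.2) ⊆ tsupport g ×ˢ tsupport u := by
    refine closure_minimal (fun q hq => ?_) ((isClosed_tsupport g).prod (isClosed_tsupport u))
    exact ⟨subset_tsupport g (left_ne_zero_of_mul hq), subset_tsupport u (right_ne_zero_of_mul hq)⟩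
  refine ⟨fun q => g q.1 * u q.2, (hg.comp contDiff_fst).mul (hu.comp contDiff_snd),
    (hgc.isCompact.prod huc.isCompact).of_isClosed_subset (isClosed_tsupport _) hsub,
    fun q hq => hu0 (hsub hq).2, fun h0 => ?_, hmain⟩
  rw [h0] at hmain
  have hgrad : ∀ q, gradSq n 0 q = 0 := fun q => by simp [gradSq, pderiv']
  simp only [hgrad, zero_mul, integral_zero, mul_zero] at hmain
  refine hmain.not_ge (setIntegral_nonneg ?_ fun q hq =>
    mul_nonneg (sq_nonneg _) (Real.rpow_nonneg (le_of_lt hq) _))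
  exact measurableSet_lt measurable_const measurable_snd
end
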